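/- arXiv:1909.03294 — 4 statements merged into one kernel-verified Lean document; each statement's English description precedes it below -/
import Mathlib

section
/- Let x be a rational number. Then L⁺(x) := (1−ax)/(1−2ax+x²) is an integer if and only if x = F⁺_n/F⁺_{n+1} for some n ≥ 0, or x = L⁺_n/L⁺_{n+1} for some n ≥ 0, or x = L⁺_{n+1}/L⁺_n for some n ≥ 0, or x = F⁺_{n+1}/F⁺_n for some n ≥ 1. -/
/-- `Lp a n` = ((a+b√m)^n + (a-b√m)^n)/2 : L⁺_0 = 1, L⁺_1 = a, L⁺_{n+2} = 2a L⁺_{n+1} - L⁺_n. -/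
def Lp (a : ℤ) : ℕ → ℤ
  | 0 => 1
  | 1 => a
  | n + 2 => 2 * a * Lp a (n + 1) - Lp a n

/-- `Fp a b n` : F⁺_0 = 0, F⁺_1 = b, F⁺_{n+2} = 2a F⁺_{n+1} - F⁺_n. -/
def Fp (a b : ℤ) : ℕ → ℤ
  | 0 => 0
  | 1 => b
  | n + 2 => 2 * a * Fp a b (n + 1) - Fp a b n

lemma Lp_Fp_succ (a : ℤ) (n : ℕ) :
    Lp a (n + 1) = a * Lp a n + (a ^ 2 - 1) * Fp a 1 n ∧
      Fp a 1 (n + 1) = Lp a n + a * Fp a 1 n := by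
  induction n with
  | zero => simp [Lp, Fp]
  | succ n ih =>
    obtain ⟨h₁, h₂⟩ := ih
    rw [Lp, Fp]
    constructor
    · linear_combination a * h₁ - (a ^ 2 - 1) * h₂
    · linear_combination a * h₂ - h₁

lemma Lp_succ (a : ℤ) (n : ℕ) : Lp a (n + 1) = a * Lp a n + (a ^ 2 - 1) * Fp a 1 n :=
  (Lp_Fp_succ a n).1

lemma Fp_succ (a : ℤ) (n : ℕ) : Fp a 1 (n + 1) = Lp a n + a * Fp a 1 n :=
  (Lp_Fp_succ a n).2

lemma Fp_eq_mul (a b : ℤ) : ∀ n : ℕ, Fp a b n = b * Fp a 1 n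
  | 0 => by simp [Fp]
  | 1 => by simp [Fp]
  | n + 2 => by
    rw [Fp, Fp, Fp_eq_mul a b (n + 1), Fp_eq_mul a b n]
    ring

lemma Lp_sq_sub (a : ℤ) (n : ℕ) : Lp a n ^ 2 - (a ^ 2 - 1) * Fp a 1 n ^ 2 = 1 := by
  induction n with
  | zero => simp [Lp, Fp]
  | succ n ih =>
    rw [Lp_succ, Fp_succ]
    linear_combination ih

lemma Lp_add (a : ℤ) (m n : ℕ) :
    Lp a (m + n) = Lp a m * Lp a n + (a ^ 2 - 1) * Fp a 1 m * Fp a 1 n ∧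
      Fp a 1 (m + n) = Lp a m * Fp a 1 n + Fp a 1 m * Lp a n := by
  induction n with
  | zero => simp [Lp, Fp]
  | succ n ih =>
    obtain ⟨h₁, h₂⟩ := ih
    rw [← add_assoc, Lp_succ, Fp_succ, Lp_succ, Fp_succ, h₁, h₂]
    constructor <;> ring

lemma Lp_two_mul (a : ℤ) (n : ℕ) : Lp a (2 * n) = 2 * Lp a n ^ 2 - 1 := by
  rw [two_mul, (Lp_add a n n).1]
  linear_combination -Lp_sq_sub a n

lemma Lp_pos_and_Fp_nonneg {a : ℤ} (ha : 1 < a) (n : ℕ) : 0 < Lp a n ∧ 0 ≤ Fp a 1 n := by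
  induction n with
  | zero => simp [Lp, Fp]
  | succ n ih =>
    obtain ⟨h₁, h₂⟩ := ih
    have hD : 0 < a ^ 2 - 1 := by nlinarith
    rw [Lp_succ, Fp_succ]
    constructor <;> positivity

lemma Fp_succ_pos {a : ℤ} (ha : 1 < a) (n : ℕ) : 0 < Fp a 1 (n + 1) := by
  obtain ⟨h₁, h₂⟩ := Lp_pos_and_Fp_nonneg ha n
  rw [Fp_succ]
  positivity

lemma even_of_even_Fp (a : ℤ) : ∀ n : ℕ, Even (Fp a 1 n) → Even n
  | 0 => by simp
  | 1 => by simp [Fp]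
  | n + 2 => fun h => by
    have hn : Even (Fp a 1 n) := by
      rw [Fp] at h
      grind
    have := even_of_even_Fp a n hn
    grind

lemma cast_xn_yn {a : ℕ} (a1 : 1 < a) (n : ℕ) :
    Lp a n = Pell.xn a1 n ∧ Fp a 1 n = Pell.yn a1 n := by
  induction n with
  | zero => simp [Lp, Fp]
  | succ n ih =>
    obtain ⟨h₁, h₂⟩ := ih
    rw [Lp_succ, Fp_succ, h₁, h₂, Pell.xn_succ, Pell.yn_succ]
    push_cast
    rw [Pell.dz_val, Pell.az]
    constructor <;> ring

/-- Every solution of `X² - (a² - 1)Y² = 1` comes from the sequences `Lp a` and `Fp a 1`. -/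
lemma exists_abs_eq_of_pell {a X Y : ℤ} (ha : 1 < a) (h : X ^ 2 - (a ^ 2 - 1) * Y ^ 2 = 1) :
    ∃ n : ℕ, |X| = Lp a n ∧ |Y| = Fp a 1 n := by
  lift a to ℕ using by lia
  have a1 : 1 < a := by exact_mod_cast ha
  have hp := (Pell.isPell_nat a1 (x := X.natAbs) (y := Y.natAbs)).1 <| by
    change (_ : ℤ) * _ - _ * _ * _ = 1
    rw [Pell.dz_val a1, Pell.az, Int.natCast_natAbs, Int.natCast_natAbs, mul_assoc,
      abs_mul_abs_self, abs_mul_abs_self]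
    linear_combination h
  obtain ⟨n, hx, hy⟩ := Pell.eq_pell a1 hp
  refine ⟨n, ?_, ?_⟩
  · rw [(cast_xn_yn a1 n).1, ← hx, Int.natCast_natAbs]
  · rw [(cast_xn_yn a1 n).2, ← hy, Int.natCast_natAbs]

/-- If `AB = a² - 1` with `A, B > 0`, then `Ax² - By² = 1` is solvable only for `A = 1`. -/
lemma eq_one_of_mul_sq_sub_mul_sq {a A B x y : ℤ} (ha : 1 < a) (hA : 0 < A)
    (hAB : A * B = a ^ 2 - 1) (h : A * x ^ 2 - B * y ^ 2 = 1) : A = 1 := by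
  have hB : 0 < B := by
    by_contra! hB
    nlinarith
  obtain ⟨n, hX, hY⟩ := exists_abs_eq_of_pell (X := A * x ^ 2 + B * y ^ 2) (Y := 2 * (x * y)) ha
    (by rw [← hAB]; linear_combination (A * x ^ 2 - B * y ^ 2 + 1) * h)
  obtain ⟨j, rfl⟩ := even_of_even_Fp a n (hY ▸ by simp [abs_mul])
  rw [← two_mul, Lp_two_mul, abs_of_nonneg (by positivity)] at hX
  have hs : y ^ 2 = A * Fp a 1 j ^ 2 := by
    refine mul_left_cancel₀ hB.ne' ?_
    have := Lp_sq_sub a j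
    rw [← hAB] at this
    linarith
  have hu : IsUnit A := isUnit_of_dvd_one ⟨x ^ 2 - B * Fp a 1 j ^ 2, by
    linear_combination -h - B * hs⟩
  rcases Int.isUnit_iff.1 hu with h | h <;> lia

/-- If `q² - 2apq + p²` divides `q(q - ap)` for coprime `p` and `q`, then it equals `1`, or it
equals `1 - a²` and `q - ap` is divisible by `a² - 1`. -/
lemma norm_cases {a p q k : ℤ} (ha : 1 < a) (hpq : IsCoprime p q)
    (hk : q * (q - a * p) = k * (q ^ 2 - 2 * a * p * q + p ^ 2)) :
    (q - a * p) ^ 2 - (a ^ 2 - 1) * p ^ 2 = 1 ∨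
      ∃ t, q - a * p = (a ^ 2 - 1) * t ∧ p ^ 2 - (a ^ 2 - 1) * t ^ 2 = 1 := by
  have hD : 0 < a ^ 2 - 1 := by nlinarith
  obtain ⟨N, hN⟩ : ∃ N, N = q ^ 2 - 2 * a * p * q + p ^ 2 := ⟨_, rfl⟩
  have hNq : IsCoprime N q := by
    have : IsCoprime (p ^ 2 + q * (q - 2 * a * p)) q :=
      (hpq.pow_left (m := 2)).add_mul_left_left _
    convert this using 1
    rw [hN]; ring
  have hNp : IsCoprime N p := by
    have : IsCoprime (q ^ 2 + p * (p - 2 * a * q)) p :=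
      (hpq.symm.pow_left (m := 2)).add_mul_left_left _
    convert this using 1
    rw [hN]; ring
  obtain ⟨t, ht⟩ : N ∣ q - a * p := hNq.dvd_of_dvd_mul_left ⟨k, by rw [hk, hN]; ring⟩
  have hp : (a ^ 2 - 1) * p ^ 2 = N * (N * t ^ 2 - 1) := by
    linear_combination (q - a * p + N * t) * ht + hN
  obtain ⟨e, he⟩ : N ∣ a ^ 2 - 1 :=
    (hNp.pow_right (n := 2)).dvd_of_dvd_mul_right ⟨_, hp⟩
  have hN0 : N ≠ 0 := by
    rintro rfl
    simp at he
    lia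
  have h1 : N * t ^ 2 - e * p ^ 2 = 1 := by
    refine mul_left_cancel₀ hN0 ?_
    linear_combination -hp + p ^ 2 * he
  rcases hN0.lt_or_gt with hneg | hpos
  · have he1 : -e = 1 := eq_one_of_mul_sq_sub_mul_sq (B := -N) (x := p) (y := t) ha
      (by by_contra! h; nlinarith) (by linear_combination -he) (by linear_combination h1)
    obtain rfl : e = -1 := by lia
    obtain rfl : N = -(a ^ 2 - 1) := by lia
    exact .inr ⟨-t, by linear_combination ht, by linear_combination h1⟩
  · obtain rfl := eq_one_of_mul_sq_sub_mul_sq ha hpos he.symm h1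
    exact .inl (by linear_combination -hN)

lemma exists_Fp_div {a p q : ℤ} (ha : 1 < a) (hq : 0 < q)
    (h : (q - a * p) ^ 2 - (a ^ 2 - 1) * p ^ 2 = 1) :
    (∃ n, p = Fp a 1 n ∧ q = Fp a 1 (n + 1)) ∨
      ∃ n, 1 ≤ n ∧ p = Fp a 1 (n + 1) ∧ q = Fp a 1 n := by
  obtain ⟨j, hX, hY⟩ := exists_abs_eq_of_pell ha h
  have hprev (i : ℕ) : a * Fp a 1 (i + 1) - Lp a (i + 1) = Fp a 1 i := by
    rw [Lp_succ, Fp_succ]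
    ring
  have hsucc := Fp_succ a j
  have hpos := Fp_succ_pos ha j
  rcases abs_choice (q - a * p) with hu | hu <;> rcases abs_choice p with hp | hp <;>
    rw [hu] at hX <;> rw [hp] at hY
  · exact .inl ⟨j, hY, by rw [hsucc, ← hX, ← hY]; ring⟩
  · obtain rfl : p = -Fp a 1 j := by lia
    rcases j with _ | i
    · exact .inl ⟨0, by simp [Fp], by simpa [Fp, Lp] using hX⟩
    · have := (Lp_pos_and_Fp_nonneg ha i).2
      linarith [hprev i]
  · subst hY
    rcases j with _ | i
    · simp [Fp, Lp] at hX
      lia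
    · have hqi : q = Fp a 1 i := by linarith [hprev i]
      refine .inr ⟨i, ?_, rfl, hqi⟩
      rcases i with _ | i
      · simp [Fp] at hqi
        lia
      · lia
  · obtain rfl : p = -Fp a 1 j := by lia
    linarith

lemma exists_Lp_div {a p q t : ℤ} (ha : 1 < a) (hq : 0 < q) (hqt : q - a * p = (a ^ 2 - 1) * t)
    (h : p ^ 2 - (a ^ 2 - 1) * t ^ 2 = 1) :
    (∃ n, p = Lp a n ∧ q = Lp a (n + 1)) ∨ ∃ n, p = Lp a (n + 1) ∧ q = Lp a n := by
  obtain ⟨j, hX, hY⟩ := exists_abs_eq_of_pell ha h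
  have hprev (i : ℕ) : a * Lp a (i + 1) - (a ^ 2 - 1) * Fp a 1 (i + 1) = Lp a i := by
    rw [Lp_succ, Fp_succ]
    ring
  have hsucc := Lp_succ a j
  have hpos := (Lp_pos_and_Fp_nonneg ha (j + 1)).1
  rcases abs_choice p with hp | hp <;> rcases abs_choice t with ht | ht <;>
    rw [hp] at hX <;> rw [ht] at hY
  · exact .inl ⟨j, hX, by rw [hsucc, ← hX, ← hY]; linarith⟩
  · obtain rfl : t = -Fp a 1 j := by lia
    subst hX
    rcases j with _ | i
    · exact .inl ⟨0, rfl, by simp [Fp, Lp] at hqt ⊢; lia⟩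
    · exact .inr ⟨i, rfl, by linarith [hprev i]⟩
  · obtain rfl : p = -Lp a j := by lia
    subst hY
    rcases j with _ | i
    · simp [Fp, Lp] at hqt
      lia
    · have := (Lp_pos_and_Fp_nonneg ha i).1
      linarith [hprev i]
  · obtain rfl : p = -Lp a j := by lia
    obtain rfl : t = -Fp a 1 j := by lia
    linarith

lemma norm_ne_zero {a p q : ℤ} (ha : 1 < a) (hq : q ≠ 0) :
    q ^ 2 - 2 * a * p * q + p ^ 2 ≠ 0 := by
  intro h
  have hu : (q - a * p) ^ 2 = p ^ 2 * (a ^ 2 - 1) := by linear_combination h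
  obtain ⟨c, hc⟩ : p ∣ q - a * p := (Int.pow_dvd_pow_iff two_ne_zero).1 ⟨_, hu⟩
  have hp : p ≠ 0 := by
    rintro rfl
    simp_all
  have hca : c ^ 2 = a ^ 2 - 1 := by
    refine mul_left_cancel₀ (pow_ne_zero 2 hp) ?_
    rw [← hu, hc]
    ring
  have h₁ : |c| < a := abs_lt_of_sq_lt_sq (by lia) (by lia)
  nlinarith [sq_abs c, abs_nonneg c]

lemma div_quadratic_eq {a p q : ℤ} (hq : q ≠ 0) :
    (1 - (a : ℚ) * (p / q)) / (1 - 2 * (a : ℚ) * (p / q) + (p / q) ^ 2) =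
      (q * (q - a * p) : ℤ) / (q ^ 2 - 2 * a * p * q + p ^ 2 : ℤ) := by
  have hq' : (q : ℚ) ≠ 0 := by exact_mod_cast hq
  rw [← mul_div_mul_left _ _ (pow_ne_zero 2 hq')]
  push_cast
  congr 1 <;> field_simp

lemma exists_int_of_mul_eq {a p q k : ℤ} (ha : 1 < a) (hq : q ≠ 0)
    (hk : q * (q - a * p) = k * (q ^ 2 - 2 * a * p * q + p ^ 2)) :
    ∃ k : ℤ, (1 - (a : ℚ) * (p / q)) / (1 - 2 * (a : ℚ) * (p / q) + (p / q) ^ 2) = k := by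
  refine ⟨k, ?_⟩
  rw [div_quadratic_eq hq, hk, Int.cast_mul,
    mul_div_cancel_right₀ _ (Int.cast_ne_zero.2 (norm_ne_zero ha hq))]

lemma Fp_div_Fp {b : ℤ} (hb : b ≠ 0) (a : ℤ) (i j : ℕ) :
    (Fp a b i / Fp a b j : ℚ) = Fp a 1 i / Fp a 1 j := by
  rw [Fp_eq_mul a b i, Fp_eq_mul a b j]
  push_cast
  exact mul_div_mul_left _ _ (by exact_mod_cast hb)

theorem L_plus_int_iff (m a b : ℤ) (hm : 0 < m) (hns : ¬ IsSquare m)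
    (ha : 0 < a) (hb : 0 < b) (hab : a ^ 2 - m * b ^ 2 = 1)
    (hmin : ∀ x y : ℤ, 0 < x → 0 < y →
      (x ^ 2 - m * y ^ 2 = 1 ∨ x ^ 2 - m * y ^ 2 = -1) → a ≤ x ∧ b ≤ y)
    (x : ℚ) :
    (∃ k : ℤ, (1 - (a : ℚ) * x) / (1 - 2 * (a : ℚ) * x + x ^ 2) = (k : ℚ)) ↔
      ((∃ n : ℕ, x = (Fp a b n : ℚ) / (Fp a b (n + 1) : ℚ)) ∨
       (∃ n : ℕ, x = (Lp a n : ℚ) / (Lp a (n + 1) : ℚ)) ∨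
       (∃ n : ℕ, x = (Lp a (n + 1) : ℚ) / (Lp a n : ℚ)) ∨
       (∃ n : ℕ, 1 ≤ n ∧ x = (Fp a b (n + 1) : ℚ) / (Fp a b n : ℚ))) := by
  have ha1 : 1 < a := by nlinarith [mul_pos hm (pow_pos hb 2)]
  simp only [Fp_div_Fp hb.ne']
  constructor
  · rintro ⟨k, hk⟩
    have hq : (0 : ℤ) < x.den := by exact_mod_cast x.den_pos
    have hx : x = (x.num : ℚ) / (x.den : ℤ) := by exact_mod_cast x.num_div_den.symm
    have hpq : IsCoprime x.num x.den := x.isCoprime_num_den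
    generalize (x.den : ℤ) = q at hq hx hpq
    generalize x.num = p at hx hpq
    subst hx
    rw [div_quadratic_eq hq.ne',
      div_eq_iff (Int.cast_ne_zero.2 (norm_ne_zero ha1 hq.ne'))] at hk
    rcases norm_cases ha1 hpq (by exact_mod_cast hk) with h | ⟨t, hqt, h⟩
    · rcases exists_Fp_div ha1 hq h with ⟨n, rfl, rfl⟩ | ⟨n, hn, rfl, rfl⟩
      · exact .inl ⟨n, rfl⟩
      · exact .inr (.inr (.inr ⟨n, hn, rfl⟩))
    · rcases exists_Lp_div ha1 hq hqt h with ⟨n, rfl, rfl⟩ | ⟨n, rfl, rfl⟩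
      · exact .inr (.inl ⟨n, rfl⟩)
      · exact .inr (.inr (.inl ⟨n, rfl⟩))
  · rintro (⟨n, rfl⟩ | ⟨n, rfl⟩ | ⟨n, rfl⟩ | ⟨n, hn, rfl⟩)
    · refine exists_int_of_mul_eq (k := Fp a 1 (n + 1) * Lp a n) ha1 (Fp_succ_pos ha1 n).ne' ?_
      rw [Fp_succ]
      linear_combination -(Lp a n + a * Fp a 1 n) * Lp a n * Lp_sq_sub a n
    · refine exists_int_of_mul_eq (k := -(Lp a (n + 1) * Fp a 1 n)) ha1
        (Lp_pos_and_Fp_nonneg ha1 (n + 1)).1.ne' ?_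
      rw [Lp_succ]
      linear_combination -(a ^ 2 - 1) * (a * Lp a n + (a ^ 2 - 1) * Fp a 1 n) * Fp a 1 n *
        Lp_sq_sub a n
    · refine exists_int_of_mul_eq (k := Lp a n * Fp a 1 (n + 1)) ha1
        (Lp_pos_and_Fp_nonneg ha1 n).1.ne' ?_
      rw [Lp_succ, Fp_succ]
      linear_combination (a ^ 2 - 1) * Lp a n * (Lp a n + a * Fp a 1 n) * Lp_sq_sub a n
    · obtain ⟨i, rfl⟩ := Nat.exists_eq_add_of_le' hn
      refine exists_int_of_mul_eq (k := -(Fp a 1 (i + 1) * Lp a (i + 2))) ha1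
        (Fp_succ_pos ha1 i).ne' ?_
      rw [Fp_succ a (i + 1), Lp_succ a (i + 1)]
      linear_combination Fp a 1 (i + 1) *
        (a * Lp a (i + 1) + (a ^ 2 - 1) * Fp a 1 (i + 1)) * Lp_sq_sub a (i + 1)
end

section
/- Let x be a rational number. Then L⁻(x) := (1−ax)/(1−2ax−x²) is an integer if and only if x = F⁻_n/F⁻_{n+1} for some n ≥ 0, or x = L⁻_n/L⁻_{n+1} for some n ≥ 0, or x = −L⁻_{n+1}/L⁻_n for some n ≥ 0, or x = −F⁻_{n+1}/F⁻_n for some n ≥ 1. -/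
/-- `Lm a n` : L⁻_0 = 1, L⁻_1 = a, L⁻_{n+2} = 2a L⁻_{n+1} + L⁻_n. -/
def Lm (a : ℤ) : ℕ → ℤ
  | 0 => 1
  | 1 => a
  | n + 2 => 2 * a * Lm a (n + 1) + Lm a n

/-- `Fm a b n` : F⁻_0 = 0, F⁻_1 = b, F⁻_{n+2} = 2a F⁻_{n+1} + F⁻_n. -/
def Fm (a b : ℤ) : ℕ → ℤ
  | 0 => 0
  | 1 => b
  | n + 2 => 2 * a * Fm a b (n + 1) + Fm a b n

theorem Fm_eq_mul (a b : ℤ) (n : ℕ) : Fm a b n = b * Fm a 1 n := by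
  induction n using Nat.twoStepInduction with
  | zero => simp [Fm]
  | one => simp [Fm]
  | more n h₀ h₁ => simp only [Fm, h₀, h₁]; ring

theorem Lm_Fm_succ (a : ℤ) (n : ℕ) :
    Lm a (n + 1) = a * Lm a n + (a ^ 2 + 1) * Fm a 1 n ∧
      Fm a 1 (n + 1) = Lm a n + a * Fm a 1 n := by
  induction n with
  | zero => simp [Lm, Fm]
  | succ n ih =>
    obtain ⟨hL, hF⟩ := ih
    simp only [Lm, Fm]
    exact ⟨by rw [hL, hF]; ring, by rw [hL, hF]; ring⟩

theorem Lm_succ (a : ℤ) (n : ℕ) :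
    Lm a (n + 1) = a * Lm a n + (a ^ 2 + 1) * Fm a 1 n :=
  (Lm_Fm_succ a n).1

theorem Fm_succ (a : ℤ) (n : ℕ) : Fm a 1 (n + 1) = Lm a n + a * Fm a 1 n :=
  (Lm_Fm_succ a n).2

theorem Lm_sq_sub_Fm_sq (a : ℤ) (n : ℕ) :
    Lm a n ^ 2 - (a ^ 2 + 1) * Fm a 1 n ^ 2 = (-1) ^ n := by
  induction n with
  | zero => simp [Lm, Fm]
  | succ n ih => rw [pow_succ (-1 : ℤ), ← ih, Lm_succ, Fm_succ]; ring

theorem Lm_Fm_two_mul (a : ℤ) (n : ℕ) :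
    Lm a (2 * n) = Lm a n ^ 2 + (a ^ 2 + 1) * Fm a 1 n ^ 2 ∧
      Fm a 1 (2 * n) = 2 * Lm a n * Fm a 1 n := by
  induction n with
  | zero => simp [Lm, Fm]
  | succ n ih =>
    rw [show 2 * (n + 1) = 2 * n + 1 + 1 by ring]
    simp only [Lm_succ, Fm_succ, ih.1, ih.2]
    constructor <;> ring

theorem Lm_pos_and_Fm_nonneg {a : ℤ} (ha : 0 < a) (n : ℕ) : 0 < Lm a n ∧ 0 ≤ Fm a 1 n := by
  induction n with
  | zero => simp [Lm, Fm]
  | succ n ih =>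
    obtain ⟨hL, hF⟩ := ih
    rw [Lm_succ, Fm_succ]
    constructor <;> positivity

theorem Lm_pos {a : ℤ} (ha : 0 < a) (n : ℕ) : 0 < Lm a n := (Lm_pos_and_Fm_nonneg ha n).1

theorem Fm_succ_pos {a : ℤ} (ha : 0 < a) (n : ℕ) : 0 < Fm a 1 (n + 1) := by
  obtain ⟨hL, hF⟩ := Lm_pos_and_Fm_nonneg ha n
  rw [Fm_succ]
  positivity

theorem exists_eq_Lm_Fm {a : ℤ} (ha : 0 < a) (N : ℕ) {s t : ℤ} (hs : 0 ≤ s) (ht : 0 ≤ t)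
    (htN : t ≤ N) (h : s ^ 2 - (a ^ 2 + 1) * t ^ 2 = 1 ∨ s ^ 2 - (a ^ 2 + 1) * t ^ 2 = -1) :
    ∃ n, s = Lm a n ∧ t = Fm a 1 n := by
  have key : t = 0 → ∃ n, s = Lm a n ∧ t = Fm a 1 n := by
    rintro rfl
    refine ⟨0, ?_, rfl⟩
    simp only [Lm]
    rcases h with h | h <;> nlinarith
  induction N generalizing s t with
  | zero => exact key (by push_cast at htN; omega)
  | succ N ih =>
    rcases ht.eq_or_lt with ht₀ | ht₀
    · exact key ht₀.symm
    have ht₁ : 1 ≤ t ^ 2 := by nlinarith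
    have hle : a * t ≤ s := by
      apply (pow_le_pow_iff_left₀ (by positivity) hs two_ne_zero).mp
      rcases h with h | h <;> nlinarith
    have hlt : s < (a + 1) * t := by
      apply lt_of_pow_lt_pow_left₀ 2 (by positivity)
      have : 1 * 1 ≤ a * t ^ 2 := mul_le_mul (by omega) ht₁ (by norm_num) ha.le
      rcases h with h | h <;> nlinarith
    have hle' : a * s ≤ (a ^ 2 + 1) * t := by
      apply (pow_le_pow_iff_left₀ (by positivity) (by positivity) two_ne_zero).mp
      have h₁ : 0 ≤ a ^ 2 * (t ^ 2 - 1) := mul_nonneg (by positivity) (by linarith)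
      have h₂ : s ^ 2 ≤ (a ^ 2 + 1) * t ^ 2 + 1 := by rcases h with h | h <;> linarith
      have h₃ := mul_le_mul_of_nonneg_left h₂ (sq_nonneg a)
      nlinarith
    have hnorm : ((a ^ 2 + 1) * t - a * s) ^ 2 - (a ^ 2 + 1) * (s - a * t) ^ 2 =
        -(s ^ 2 - (a ^ 2 + 1) * t ^ 2) := by ring
    have h' : ((a ^ 2 + 1) * t - a * s) ^ 2 - (a ^ 2 + 1) * (s - a * t) ^ 2 = 1 ∨
        ((a ^ 2 + 1) * t - a * s) ^ 2 - (a ^ 2 + 1) * (s - a * t) ^ 2 = -1 := by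
      rw [hnorm]
      rcases h with h | h <;> simp [h]
    obtain ⟨n, hn₁, hn₂⟩ := ih (s := (a ^ 2 + 1) * t - a * s) (t := s - a * t)
      (by linarith) (by linarith) (by push_cast at htN; linarith) h' (by
        intro h₀
        refine ⟨0, ?_, h₀⟩
        rw [h₀] at h'
        simp only [Lm]
        rcases h' with h' | h' <;> nlinarith)
    refine ⟨n + 1, ?_, ?_⟩
    · rw [Lm_succ, ← hn₁, ← hn₂]; ring
    · rw [Fm_succ, ← hn₁, ← hn₂]; ring

/-- Solutions of the negative Pell equation for `a ^ 2 + 1`, in terms of half the index. -/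
theorem exists_index_of_neg_pell {a s t : ℤ} (ha : 0 < a) (hs : 0 ≤ s) (ht : 0 ≤ t)
    (h : s ^ 2 - (a ^ 2 + 1) * t ^ 2 = -1) :
    ∃ j, s = a * (Lm a j ^ 2 + (a ^ 2 + 1) * Fm a 1 j ^ 2) +
        (a ^ 2 + 1) * (2 * Lm a j * Fm a 1 j) ∧
      t = Lm a j ^ 2 + (a ^ 2 + 1) * Fm a 1 j ^ 2 + a * (2 * Lm a j * Fm a 1 j) := by
  obtain ⟨n, rfl, rfl⟩ := exists_eq_Lm_Fm ha t.toNat hs ht (by omega) (Or.inr h)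
  rw [Lm_sq_sub_Fm_sq] at h
  rcases n.even_or_odd with hn | ⟨j, rfl⟩
  · rw [hn.neg_one_pow] at h
    norm_num at h
  · obtain ⟨hL, hF⟩ := Lm_Fm_two_mul a j
    exact ⟨j, by rw [Lm_succ, hL, hF], by rw [Fm_succ, hL, hF]⟩

theorem one_sub_two_mul_sub_sq_ne_zero {a : ℤ} (ha : 0 < a) (x : ℚ) :
    1 - 2 * (a : ℚ) * x - x ^ 2 ≠ 0 := by
  intro h
  have hsq : IsSquare ((a ^ 2 + 1 : ℤ) : ℚ) := ⟨x + a, by push_cast; linear_combination h⟩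
  obtain ⟨r, hr⟩ := Rat.isSquare_intCast_iff.mp hsq
  have h₁ : a < |r| := lt_of_pow_lt_pow_left₀ 2 (abs_nonneg r) (by rw [sq_abs]; linarith)
  have h₂ : |r| < a + 1 :=
    lt_of_pow_lt_pow_left₀ 2 (by positivity) (by rw [sq_abs]; nlinarith)
  omega

/-- The roots of `k x ^ 2 + (2 k - 1) a x + (1 - k)`, when `2 k - 1` and the square root of the
discriminant are expressed through `P + Q √(a ^ 2 + 1)` of norm `e`. -/
theorem ratio_of_sqrt_disc {a k x P Q P' Q' e σ τ : ℚ} (hk : k ≠ 0) (hP₀ : P ≠ 0) (hP₀' : P' ≠ 0)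
    (hQ₀' : Q' ≠ 0) (hP' : P' = a * P + (a ^ 2 + 1) * Q) (hQ' : Q' = P + a * Q)
    (he : e = 1 ∨ e = -1) (hσ : σ = 1 ∨ σ = -1) (hτ : τ = 1 ∨ τ = -1)
    (hnorm : P ^ 2 - (a ^ 2 + 1) * Q ^ 2 = e)
    (ht : 2 * k - 1 = σ * (P ^ 2 + (a ^ 2 + 1) * Q ^ 2 + a * (2 * P * Q)))
    (hs : 2 * k * x + (2 * k - 1) * a =
      τ * (a * (P ^ 2 + (a ^ 2 + 1) * Q ^ 2) + (a ^ 2 + 1) * (2 * P * Q))) :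
    x = Q / Q' ∨ x = P / P' ∨ x = -(P' / P) ∨ Q ≠ 0 ∧ x = -(Q' / Q) := by
  have hσ₂ : σ ^ 2 = 1 := by rcases hσ with rfl | rfl <;> norm_num
  have hσe : σ = e ∨ σ = -e := by
    rcases hσ with rfl | rfl <;> rcases he with rfl | rfl <;> norm_num
  have hτσ : τ = σ ∨ τ = -σ := by
    rcases hσ with rfl | rfl <;> rcases hτ with rfl | rfl <;> norm_num
  have hx : k * x = σ * (P * Q) ∨ k * x = -(σ * (P' * Q')) := by
    rcases hτσ with rfl | rfl
    · left; linear_combination (1 / 2) * hs - (a / 2) * ht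
    · right; rw [hP', hQ']; linear_combination (1 / 2) * hs - (a / 2) * ht
  rcases hσe with rfl | hσe
  · have hkσ : k = σ * (P * Q') := by
      rw [hQ']; linear_combination (1 / 2) * ht - (σ / 2) * hnorm - (1 / 2) * hσ₂
    rcases hx with hx | hx
    · left
      rw [eq_div_iff hQ₀']
      refine mul_left_cancel₀ (mul_ne_zero hk hP₀) ?_
      linear_combination (P * Q') * hx - (P * Q) * hkσ
    · right; right; left
      rw [← neg_div, eq_div_iff hP₀]
      refine mul_left_cancel₀ (mul_ne_zero hk hQ₀') ?_
      linear_combination (P * Q') * hx + (P' * Q') * hkσ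
  · have hkσ : k = σ * (P' * Q) := by
      rw [hP']
      linear_combination (1 / 2) * ht + (σ / 2) * hnorm - (1 / 2) * hσ₂ + (σ / 2) * hσe
    have hQ₀ : Q ≠ 0 := by
      rintro rfl
      exact hk (by rw [hkσ]; ring)
    rcases hx with hx | hx
    · right; left
      rw [eq_div_iff hP₀']
      refine mul_left_cancel₀ (mul_ne_zero hk hQ₀) ?_
      linear_combination (P' * Q) * hx - (P * Q) * hkσ
    · right; right; right
      refine ⟨hQ₀, ?_⟩
      rw [← neg_div, eq_div_iff hQ₀]
      refine mul_left_cancel₀ (mul_ne_zero hk hP₀') ?_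
      linear_combination (P' * Q) * hx + (P' * Q') * hkσ

theorem exists_ratio_of_quadratic {a k : ℤ} (ha : 0 < a) {x : ℚ}
    (h : (k : ℚ) * x ^ 2 + (2 * k - 1) * a * x + (1 - k) = 0) :
    (∃ n : ℕ, x = (Fm a 1 n : ℚ) / (Fm a 1 (n + 1) : ℚ)) ∨
      (∃ n : ℕ, x = (Lm a n : ℚ) / (Lm a (n + 1) : ℚ)) ∨
      (∃ n : ℕ, x = -((Lm a (n + 1) : ℚ) / (Lm a n : ℚ))) ∨
      (∃ n : ℕ, 1 ≤ n ∧ x = -((Fm a 1 (n + 1) : ℚ) / (Fm a 1 n : ℚ))) := by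
  rcases eq_or_ne k 0 with rfl | hk
  · have ha' : (a : ℚ) ≠ 0 := by exact_mod_cast ha.ne'
    refine Or.inr (Or.inl ⟨0, ?_⟩)
    simp only [Lm]
    push_cast at h ⊢
    rw [eq_div_iff ha']
    linear_combination -h
  have hsq : IsSquare (((a ^ 2 + 1) * (2 * k - 1) ^ 2 - 1 : ℤ) : ℚ) :=
    ⟨2 * k * x + (2 * k - 1) * a, by push_cast; linear_combination (-4 * (k : ℚ)) * h⟩
  obtain ⟨r, hr⟩ := Rat.isSquare_intCast_iff.mp hsq
  obtain ⟨j, hs, ht⟩ := exists_index_of_neg_pell ha (abs_nonneg r) (abs_nonneg (2 * k - 1))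
    (by rw [sq_abs, sq_abs]; linarith)
  have hroot : 2 * k * x + (2 * k - 1) * a = ((|r| : ℤ) : ℚ) ∨
      2 * k * x + (2 * k - 1) * a = -((|r| : ℤ) : ℚ) := by
    apply sq_eq_sq_iff_eq_or_eq_neg.mp
    rw [← Int.cast_pow, sq_abs, sq, sq, ← hr]
    push_cast
    linear_combination (4 * (k : ℚ)) * h
  have hnorm : (Lm a j : ℚ) ^ 2 - (a ^ 2 + 1) * (Fm a 1 j : ℚ) ^ 2 = (-1) ^ j := by
    exact_mod_cast Lm_sq_sub_Fm_sq a j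
  have hP' : (Lm a (j + 1) : ℚ) = a * Lm a j + (a ^ 2 + 1) * Fm a 1 j := by
    exact_mod_cast Lm_succ a j
  have hQ' : (Fm a 1 (j + 1) : ℚ) = Lm a j + a * Fm a 1 j := by
    exact_mod_cast Fm_succ a j
  rw [hs] at hroot
  push_cast at hroot
  have hσ : ∃ σ : ℚ, (σ = 1 ∨ σ = -1) ∧ (2 * k - 1 : ℚ) = σ * ((Lm a j : ℚ) ^ 2 +
      (a ^ 2 + 1) * (Fm a 1 j : ℚ) ^ 2 + a * (2 * Lm a j * Fm a 1 j)) := by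
    rcases abs_choice (2 * k - 1) with habs | habs
    · exact ⟨1, Or.inl rfl, by rw [one_mul]; exact_mod_cast habs.symm.trans ht⟩
    · refine ⟨-1, Or.inr rfl, ?_⟩
      have hneg : 2 * k - 1 = -1 * (Lm a j ^ 2 + (a ^ 2 + 1) * Fm a 1 j ^ 2 +
        a * (2 * Lm a j * Fm a 1 j)) := by rw [← ht, habs]; ring
      exact_mod_cast hneg
  have hτ : ∃ τ : ℚ, (τ = 1 ∨ τ = -1) ∧ 2 * k * x + (2 * k - 1) * a =
      τ * (a * ((Lm a j : ℚ) ^ 2 + (a ^ 2 + 1) * (Fm a 1 j : ℚ) ^ 2) +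
        (a ^ 2 + 1) * (2 * Lm a j * Fm a 1 j)) := by
    rcases hroot with hroot | hroot
    · exact ⟨1, Or.inl rfl, by rw [hroot, one_mul]⟩
    · exact ⟨-1, Or.inr rfl, by rw [hroot, neg_one_mul]⟩
  obtain ⟨σ, hσ, hσt⟩ := hσ
  obtain ⟨τ, hτ, hτs⟩ := hτ
  rcases ratio_of_sqrt_disc (by exact_mod_cast hk) (by exact_mod_cast (Lm_pos ha j).ne')
    (by exact_mod_cast (Lm_pos ha (j + 1)).ne') (by exact_mod_cast (Fm_succ_pos ha j).ne')
    hP' hQ' (neg_one_pow_eq_or ℚ j) hσ hτ hnorm hσt hτs with h | h | h | ⟨h₀, h⟩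
  · exact Or.inl ⟨j, h⟩
  · exact Or.inr (Or.inl ⟨j, h⟩)
  · exact Or.inr (Or.inr (Or.inl ⟨j, h⟩))
  · refine Or.inr (Or.inr (Or.inr ⟨j, Nat.one_le_iff_ne_zero.mpr ?_, h⟩))
    rintro rfl
    exact h₀ (by simp [Fm])

theorem ratio_value_eq {a k u v : ℚ} (hv : v ≠ 0)
    (hden : 1 - 2 * a * (u / v) - (u / v) ^ 2 ≠ 0)
    (h : v * (v - a * u) = k * (v ^ 2 - 2 * a * u * v - u ^ 2)) :
    (1 - a * (u / v)) / (1 - 2 * a * (u / v) - (u / v) ^ 2) = k := by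
  rw [div_eq_iff hden]
  field_simp
  linear_combination h

theorem L_minus_int_iff (m a b : ℤ) (hm : 0 < m) (hns : ¬ IsSquare m)
    (ha : 0 < a) (hb : 0 < b) (hab : a ^ 2 - m * b ^ 2 = -1)
    (hmin : ∀ x y : ℤ, 0 < x → 0 < y →
      (x ^ 2 - m * y ^ 2 = 1 ∨ x ^ 2 - m * y ^ 2 = -1) → a ≤ x ∧ b ≤ y)
    (x : ℚ) :
    (∃ k : ℤ, (1 - (a : ℚ) * x) / (1 - 2 * (a : ℚ) * x - x ^ 2) = (k : ℚ)) ↔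
      ((∃ n : ℕ, x = (Fm a b n : ℚ) / (Fm a b (n + 1) : ℚ)) ∨
       (∃ n : ℕ, x = (Lm a n : ℚ) / (Lm a (n + 1) : ℚ)) ∨
       (∃ n : ℕ, x = -((Lm a (n + 1) : ℚ) / (Lm a n : ℚ))) ∨
       (∃ n : ℕ, 1 ≤ n ∧ x = -((Fm a b (n + 1) : ℚ) / (Fm a b n : ℚ)))) := by
  have hb' : (b : ℚ) ≠ 0 := by exact_mod_cast hb.ne'
  simp only [Fm_eq_mul a b, Int.cast_mul, mul_div_mul_left _ _ hb']
  have hden := one_sub_two_mul_sub_sq_ne_zero ha x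
  constructor
  · rintro ⟨k, hk⟩
    rw [div_eq_iff hden] at hk
    exact exists_ratio_of_quadratic ha (k := k) (by linear_combination hk)
  have hLm (n : ℕ) : (Lm a (n + 1) : ℚ) = a * Lm a n + (a ^ 2 + 1) * Fm a 1 n := by
    exact_mod_cast Lm_succ a n
  have hFm (n : ℕ) : (Fm a 1 (n + 1) : ℚ) = Lm a n + a * Fm a 1 n := by
    exact_mod_cast Fm_succ a n
  have hnorm (n : ℕ) : (Lm a n : ℚ) ^ 2 - (a ^ 2 + 1) * (Fm a 1 n : ℚ) ^ 2 = (-1) ^ n := by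
    exact_mod_cast Lm_sq_sub_Fm_sq a n
  have hsign (n : ℕ) : ((-1 : ℚ) ^ n) ^ 2 = 1 := by rw [← pow_mul, mul_comm, pow_mul]; norm_num
  have hL₀ (n : ℕ) : (Lm a n : ℚ) ≠ 0 := by exact_mod_cast (Lm_pos ha n).ne'
  have hF₀ (n : ℕ) : (Fm a 1 (n + 1) : ℚ) ≠ 0 := by exact_mod_cast (Fm_succ_pos ha n).ne'
  rintro (⟨n, rfl⟩ | ⟨n, rfl⟩ | ⟨n, rfl⟩ | ⟨n, hn, rfl⟩)
  · refine ⟨(-1) ^ n * (Fm a 1 (n + 1) * Lm a n), ?_⟩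
    refine ratio_value_eq (hF₀ n) hden ?_
    push_cast
    rw [hFm]
    linear_combination -((Lm a n + a * Fm a 1 n : ℚ) * Lm a n) *
      (hsign n + (-1) ^ n * hnorm n)
  · refine ⟨-((-1) ^ n * (Lm a (n + 1) * Fm a 1 n)), ?_⟩
    refine ratio_value_eq (hL₀ (n + 1)) hden ?_
    push_cast
    rw [hLm]
    linear_combination -((a ^ 2 + 1) * Fm a 1 n * (a * Lm a n + (a ^ 2 + 1) * Fm a 1 n : ℚ)) *
      (hsign n + (-1) ^ n * hnorm n)
  · refine ⟨(-1) ^ n * (Lm a n * Fm a 1 (n + 1)), ?_⟩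
    rw [← neg_div] at hden ⊢
    refine ratio_value_eq (hL₀ n) hden ?_
    push_cast
    rw [hLm, hFm]
    linear_combination -((a ^ 2 + 1) * Lm a n * (Lm a n + a * Fm a 1 n : ℚ)) *
      (hsign n + (-1) ^ n * hnorm n)
  · refine ⟨-((-1) ^ n * (Fm a 1 n * Lm a (n + 1))), ?_⟩
    have hF : (Fm a 1 n : ℚ) ≠ 0 := by
      obtain ⟨j, rfl⟩ := Nat.exists_eq_add_of_le' hn
      exact hF₀ j
    rw [← neg_div] at hden ⊢
    refine ratio_value_eq hF hden ?_
    push_cast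
    rw [hLm, hFm]
    linear_combination -(Fm a 1 n * (a * Lm a n + (a ^ 2 + 1) * Fm a 1 n : ℚ)) *
      (hsign n + (-1) ^ n * hnorm n)
end

section
/- Let x be a rational number. Then F⁺(x) := bx/(1−2ax+x²) is an integer if and only if x = F⁺_n/F⁺_{n+1} for some n ≥ 0, or x = F⁺_{n+1}/F⁺_n for some n ≥ 1. -/
theorem Fp_nonneg_and_lt_succ {a b : ℤ} (ha : 0 < a) (hb : 0 < b) (n : ℕ) :
    0 ≤ Fp a b n ∧ Fp a b n < Fp a b (n + 1) := by
  induction n with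
  | zero => simpa [Fp] using hb
  | succ n ih =>
    obtain ⟨h0, h1⟩ := ih
    refine ⟨by omega, ?_⟩
    rw [Fp]
    nlinarith

theorem Fp_quadratic_form (a b : ℤ) (n : ℕ) :
    Fp a b n ^ 2 - 2 * a * Fp a b n * Fp a b (n + 1) + Fp a b (n + 1) ^ 2 = b ^ 2 := by
  induction n with
  | zero => simp [Fp]
  | succ n ih => rw [← ih, Fp]; ring

theorem dvd_Fp (a b : ℤ) (n : ℕ) : b ∣ Fp a b n := by
  induction n using Nat.twoStepInduction with
  | zero => simp [Fp]
  | one => simp [Fp]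
  | more n h0 h1 => rw [Fp]; exact (h1.mul_left _).sub h0

theorem two_mul_sub_two_le_abs_of_mul_neg {a p q : ℤ} (ha : 0 < a) (h : p * q < 0) :
    2 * a - 2 ≤ |p ^ 2 - 2 * a * p * q + q ^ 2| :=
  le_trans (by nlinarith [sq_nonneg p, sq_nonneg q]) (le_abs_self _)

/-- Vieta descent: a coprime pair at which the form `p ^ 2 - 2 a p q + q ^ 2` takes a value smaller
than `2 a - 2` is proportional to a pair of consecutive terms of `Fp a b`. -/
theorem exists_mul_eq_Fp {a : ℤ} (b : ℤ) (ha : 0 < a) (q : ℕ) :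
    ∀ p : ℤ, (q : ℤ) < p → IsCoprime p (q : ℤ) →
      |p ^ 2 - 2 * a * p * q + (q : ℤ) ^ 2| < 2 * a - 2 →
      ∃ n : ℕ, b * q = Fp a b n ∧ b * p = Fp a b (n + 1) := by
  induction q using Nat.strong_induction_on with
  | _ q ih =>
    intro p hqp hco hN
    rcases Nat.eq_zero_or_pos q with rfl | hq
    · have hp : p = 1 := by
        have := Int.isUnit_iff.1 (isCoprime_zero_right.1 (by simpa using hco))
        simp at hqp
        omega
      exact ⟨0, by simp [Fp], by simp [Fp, hp]⟩
    · have hq' : (0 : ℤ) < q := by exact_mod_cast hq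
      obtain ⟨r, hr⟩ : ∃ r, r = 2 * a * q - p := ⟨_, rfl⟩
      have hform : (q : ℤ) ^ 2 - 2 * a * q * r + r ^ 2 = p ^ 2 - 2 * a * p * q + q ^ 2 := by
        rw [hr]; ring
      have hr0 : 0 ≤ r := by
        by_contra! h
        have := two_mul_sub_two_le_abs_of_mul_neg ha (mul_neg_of_pos_of_neg hq' h)
        rw [hform] at this
        omega
      have hrq : r < q := by
        by_contra! h
        have h1 := (abs_lt.1 hN).1
        have h2 : 0 ≤ (p - q) * (r - q) := mul_nonneg (by omega) (by omega)
        have h3 : (2 * a - 2) * 1 ≤ (2 * a - 2) * (q : ℤ) ^ 2 :=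
          mul_le_mul_of_nonneg_left (by nlinarith) (by omega)
        rw [hr] at h2
        nlinarith
      lift r to ℕ using hr0
      have hco' : IsCoprime (q : ℤ) (r : ℤ) := by
        have : (r : ℤ) = -p + q * (2 * a) := by rw [hr]; ring
        rw [this]
        exact (hco.symm.neg_right).add_mul_left_right _
      obtain ⟨n, h1, h2⟩ := ih r (by omega) q hrq hco' (by rwa [hform])
      refine ⟨n + 1, h2, ?_⟩
      rw [Fp, ← h1, ← h2, hr]
      ring

theorem lt_two_mul_sub_two_of_pell {m a b : ℤ} (hm : 0 < m) (hns : ¬ IsSquare m)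
    (ha : 0 < a) (hb : 0 < b) (hab : a ^ 2 - m * b ^ 2 = 1) : b < 2 * a - 2 := by
  have hm2 : 2 ≤ m := by
    by_contra! h
    exact hns ⟨1, by omega⟩
  have h : 2 * b ^ 2 ≤ a ^ 2 - 1 := by nlinarith [sq_nonneg b]
  have ha2 : 2 ≤ a := by nlinarith
  by_contra! hge
  nlinarith

/-- If `b x / (1 - 2 a x + x ^ 2)` is an integer (possibly through division by zero) at `x = p / q`
in lowest terms, the form `p ^ 2 - 2 a p q + q ^ 2` divides `b` or vanishes. -/
theorem abs_form_le_of_div_eq_int {a b k p q : ℤ} (hb : 0 < b) (hq : q ≠ 0) (hco : IsCoprime p q)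
    (h : (b : ℚ) * (p / q) / (1 - 2 * a * (p / q) + (p / q) ^ 2) = k) :
    |p ^ 2 - 2 * a * p * q + q ^ 2| ≤ b := by
  by_cases hN : p ^ 2 - 2 * a * p * q + q ^ 2 = 0
  · simpa [hN] using hb.le
  have hqQ : (q : ℚ) ≠ 0 := by exact_mod_cast hq
  have hNQ : (p ^ 2 - 2 * a * p * q + q ^ 2 : ℚ) ≠ 0 := by exact_mod_cast hN
  have hden : 1 - 2 * a * (p / q) + (p / q : ℚ) ^ 2 = (p ^ 2 - 2 * a * p * q + q ^ 2) / q ^ 2 := by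
    field_simp
    ring
  have hk : b * (p * q) = k * (p ^ 2 - 2 * a * p * q + q ^ 2) := by
    rw [hden, div_eq_iff (div_ne_zero hNQ (pow_ne_zero 2 hqQ))] at h
    field_simp at h
    have h' : (b * (p * q) : ℚ) = k * (p ^ 2 - 2 * a * p * q + q ^ 2) := by linear_combination h
    exact_mod_cast h'
  have hp : IsCoprime (p ^ 2 - 2 * a * p * q + q ^ 2) p := by
    have : p ^ 2 - 2 * a * p * q + q ^ 2 = q ^ 2 + p * (p - 2 * a * q) := by ring
    rw [this]
    exact (hco.symm.pow_left).add_mul_left_left _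
  have hq : IsCoprime (p ^ 2 - 2 * a * p * q + q ^ 2) q := by
    have : p ^ 2 - 2 * a * p * q + q ^ 2 = p ^ 2 + q * (q - 2 * a * p) := by ring
    rw [this]
    exact (hco.pow_left).add_mul_left_left _
  have hdvd : p ^ 2 - 2 * a * p * q + q ^ 2 ∣ b :=
    (hp.mul_right hq).dvd_of_dvd_mul_right ⟨k, by rw [hk]; ring⟩
  exact Int.le_of_dvd hb ((abs_dvd _ _).2 hdvd)

theorem exists_int_eq_div_of_form_eq {a b u v : ℤ} (hb : 0 < b) (hv : 0 < v) (hu : b ∣ u)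
    (h : u ^ 2 - 2 * a * u * v + v ^ 2 = b ^ 2) :
    ∃ k : ℤ, (b : ℚ) * (u / v) / (1 - 2 * a * (u / v) + (u / v) ^ 2) = k := by
  obtain ⟨w, rfl⟩ := hu
  have hbQ : (b : ℚ) ≠ 0 := by exact_mod_cast hb.ne'
  have hvQ : (v : ℚ) ≠ 0 := by exact_mod_cast hv.ne'
  have hQ : ((b * w) ^ 2 - 2 * a * (b * w) * v + v ^ 2 : ℚ) = b ^ 2 := by exact_mod_cast h
  have hden : 1 - 2 * a * ((b * w : ℤ) / v) + ((b * w : ℤ) / v : ℚ) ^ 2 = b ^ 2 / v ^ 2 := by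
    rw [← hQ]
    push_cast
    field_simp
    ring
  refine ⟨w * v, ?_⟩
  rw [hden]
  push_cast
  field_simp

theorem F_plus_int_iff (m a b : ℤ) (hm : 0 < m) (hns : ¬ IsSquare m)
    (ha : 0 < a) (hb : 0 < b) (hab : a ^ 2 - m * b ^ 2 = 1)
    (hmin : ∀ x y : ℤ, 0 < x → 0 < y →
      (x ^ 2 - m * y ^ 2 = 1 ∨ x ^ 2 - m * y ^ 2 = -1) → a ≤ x ∧ b ≤ y)
    (x : ℚ) :
    (∃ k : ℤ, ((b : ℚ) * x) / (1 - 2 * (a : ℚ) * x + x ^ 2) = (k : ℚ)) ↔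
      ((∃ n : ℕ, x = (Fp a b n : ℚ) / (Fp a b (n + 1) : ℚ)) ∨
       (∃ n : ℕ, 1 ≤ n ∧ x = (Fp a b (n + 1) : ℚ) / (Fp a b n : ℚ))) := by
  have hbQ : (b : ℚ) ≠ 0 := by exact_mod_cast hb.ne'
  have hpos : ∀ n, 0 < Fp a b (n + 1) := fun n =>
    (Fp_nonneg_and_lt_succ ha hb n).1.trans_lt (Fp_nonneg_and_lt_succ ha hb n).2
  constructor
  · rintro ⟨k, hk⟩
    obtain ⟨p, q, hq, hco, rfl⟩ : ∃ p q : ℤ, 0 < q ∧ IsCoprime p q ∧ x = p / q :=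
      ⟨x.num, x.den, by exact_mod_cast x.pos, Rat.isCoprime_num_den x,
        by exact_mod_cast (Rat.num_div_den x).symm⟩
    have hN := (abs_form_le_of_div_eq_int hb hq.ne' hco hk).trans_lt
      (lt_two_mul_sub_two_of_pell hm hns ha hb hab)
    have hp : 0 ≤ p := by
      by_contra! h
      have := two_mul_sub_two_le_abs_of_mul_neg ha (mul_neg_of_neg_of_pos h hq)
      omega
    lift p to ℕ using hp
    lift q to ℕ using hq.le
    rcases lt_trichotomy (p : ℤ) q with h | h | h
    · obtain ⟨n, h1, h2⟩ := exists_mul_eq_Fp b ha p q h hco.symm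
        (lt_of_eq_of_lt (congrArg abs (by ring)) hN)
      refine Or.inl ⟨n, ?_⟩
      rw [← h1, ← h2]
      push_cast
      rw [mul_div_mul_left _ _ hbQ]
    · rw [h] at hN
      have h1 := (abs_lt.1 hN).1
      have h3 : (2 * a - 2) * 1 ≤ (2 * a - 2) * (q : ℤ) ^ 2 :=
        mul_le_mul_of_nonneg_left (by nlinarith) (by omega)
      nlinarith
    · obtain ⟨n, h1, h2⟩ := exists_mul_eq_Fp b ha q p h hco hN
      refine Or.inr ⟨n, Nat.one_le_iff_ne_zero.2 ?_, ?_⟩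
      · rintro rfl
        exact (mul_pos hb hq).ne' h1
      · rw [← h1, ← h2]
        push_cast
        rw [mul_div_mul_left _ _ hbQ]
  · rintro (⟨n, rfl⟩ | ⟨n, hn, rfl⟩)
    · exact exists_int_eq_div_of_form_eq hb (hpos n) (dvd_Fp a b n) (Fp_quadratic_form a b n)
    · obtain ⟨n, rfl⟩ := Nat.exists_eq_add_of_le' hn
      exact exists_int_eq_div_of_form_eq hb (hpos n) (dvd_Fp a b _)
        (by rw [← Fp_quadratic_form a b (n + 1)]; ring)
end

section
/- Let x be a rational number with |x| < 1/(a + b√m). Then F⁺(x) := bx/(1−2ax+x²) is an integer if and only if x = F⁺_n/F⁺_{n+1} for some n ≥ 0. -/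
theorem Fp_succ_sq (a b : ℤ) (n : ℕ) :
    Fp a b (n + 1) ^ 2 - 2 * a * Fp a b n * Fp a b (n + 1) + Fp a b n ^ 2 = b ^ 2 := by
  induction n with
  | zero => simp [Fp]
  | succ n ih =>
    rw [Fp, ← ih]
    ring

/-- Coprime pairs at which the form `q² - 2apq + p²` takes a small positive value are, up to the
factor `b`, consecutive terms of `Fp a b`; the proof is by Vieta descent. -/
theorem exists_Fp_of_form_le {a b : ℤ} (hb : 0 < b) (hba : b < a) (p : ℕ) :
    ∀ q : ℤ, (p : ℤ) < q → IsCoprime (p : ℤ) q → 0 < q ^ 2 - 2 * a * p * q + (p : ℤ) ^ 2 →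
      q ^ 2 - 2 * a * p * q + (p : ℤ) ^ 2 ≤ b →
      ∃ n : ℕ, b * p = Fp a b n ∧ b * q = Fp a b (n + 1) := by
  induction p using Nat.strong_induction_on with
  | _ p ih =>
    intro q hpq hcop hpos hle
    rcases Nat.eq_zero_or_pos p with rfl | hp
    · have hq : q = 1 := by
        rw [Nat.cast_zero, isCoprime_zero_left, Int.isUnit_iff] at hcop
        omega
      exact ⟨0, by simp [Fp], by simp [Fp, hq]⟩
    have hp' : (0 : ℤ) < p := by exact_mod_cast hp
    have hr : 0 ≤ 2 * a * p - q := by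
      by_contra! hneg
      have hq : 2 * a * p + 1 ≤ q := by linarith
      nlinarith [mul_pos (hb.trans hba) hp', mul_nonneg (hb.trans hba).le hp'.le]
    have hrp : 2 * a * p - q < p := by
      by_contra! hge
      nlinarith
    obtain ⟨r, hr_eq⟩ := Int.eq_ofNat_of_zero_le hr
    have hform : (p : ℤ) ^ 2 - 2 * a * r * p + (r : ℤ) ^ 2
        = q ^ 2 - 2 * a * p * q + (p : ℤ) ^ 2 := by
      rw [← hr_eq]
      ring
    have hcop' : IsCoprime (r : ℤ) p := by
      obtain ⟨u, v, huv⟩ := hcop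
      exact ⟨-v, u + 2 * a * v, by rw [← hr_eq, ← huv]; ring⟩
    obtain ⟨n, h₀, h₁⟩ := ih r (by omega) p (by omega) hcop'
      (hform ▸ hpos) (hform ▸ hle)
    refine ⟨n + 1, h₁, ?_⟩
    rw [Fp, ← h₀, ← h₁, ← hr_eq]
    ring

theorem F_plus_int_iff_conv (m a b : ℤ) (hm : 0 < m) (hns : ¬ IsSquare m)
    (ha : 0 < a) (hb : 0 < b) (hab : a ^ 2 - m * b ^ 2 = 1)
    (hmin : ∀ x y : ℤ, 0 < x → 0 < y →
      (x ^ 2 - m * y ^ 2 = 1 ∨ x ^ 2 - m * y ^ 2 = -1) → a ≤ x ∧ b ≤ y)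
    (x : ℚ) (hconv : |(x : ℝ)| < 1 / ((a : ℝ) + (b : ℝ) * Real.sqrt (m : ℝ))) :
    (∃ k : ℤ, ((b : ℚ) * x) / (1 - 2 * (a : ℚ) * x + x ^ 2) = (k : ℚ)) ↔
      (∃ n : ℕ, x = (Fp a b n : ℚ) / (Fp a b (n + 1) : ℚ)) := by
  have hba : b < a := by nlinarith
  constructor
  · rintro ⟨k, hk⟩
    have hs : 0 < (b : ℝ) * √(m : ℝ) := by positivity
    have ha1 : (1 : ℝ) ≤ a := by exact_mod_cast ha
    have hnorm : (a : ℝ) ^ 2 - (b * √(m : ℝ)) ^ 2 = 1 := by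
      rw [mul_pow, Real.sq_sqrt (by positivity)]
      have : (a : ℝ) ^ 2 - m * b ^ 2 = 1 := by exact_mod_cast hab
      linarith
    have hinv : 1 / ((a : ℝ) + b * √(m : ℝ)) = a - b * √(m : ℝ) := by
      rw [div_eq_iff (by positivity)]
      linarith
    have hx_lt_one : |x| < 1 := by
      have : |(x : ℝ)| < 1 := hconv.trans_le
        ((div_le_one (by positivity)).2 (by linarith))
      exact_mod_cast this
    have hden : 0 < 1 - 2 * (a : ℚ) * x + x ^ 2 := by
      have : (0 : ℝ) < 1 - 2 * a * x + (x : ℝ) ^ 2 := by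
        rw [hinv] at hconv
        have := (abs_lt.1 hconv).2
        nlinarith
      exact_mod_cast this
    have hq : (0 : ℤ) < x.den := by exact_mod_cast x.den_pos
    have hqQ : (0 : ℚ) < x.den := by exact_mod_cast x.den_pos
    have hx : x * x.den = x.num := Rat.mul_den_eq_num x
    have hcop : IsCoprime x.num (x.den : ℤ) := Rat.isCoprime_num_den x
    have hform : (x.den : ℚ) ^ 2 - 2 * a * x.num * x.den + (x.num : ℚ) ^ 2
        = (1 - 2 * a * x + x ^ 2) * x.den ^ 2 := by
      rw [← hx]
      ring
    have hpos : 0 < (x.den : ℤ) ^ 2 - 2 * a * x.num * x.den + x.num ^ 2 := by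
      have := hform ▸ mul_pos hden (pow_pos hqQ 2)
      exact_mod_cast this
    have hmul : b * (x.num * x.den)
        = k * ((x.den : ℤ) ^ 2 - 2 * a * x.num * x.den + x.num ^ 2) := by
      rw [div_eq_iff hden.ne'] at hk
      have : (b : ℚ) * (x.num * x.den)
          = k * ((x.den : ℚ) ^ 2 - 2 * a * x.num * x.den + (x.num : ℚ) ^ 2) := by
        rw [hform, ← mul_assoc (k : ℚ), ← hk, ← hx]
        ring
      exact_mod_cast this
    have hcop_form : IsCoprime ((x.den : ℤ) ^ 2 - 2 * a * x.num * x.den + x.num ^ 2)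
        (x.num * x.den) := by
      refine IsCoprime.mul_right ?_ ?_
      · have := (hcop.symm.pow_left (m := 2)).add_mul_right_left (x.num - 2 * a * x.den)
        rwa [show (x.den : ℤ) ^ 2 + (x.num - 2 * a * x.den) * x.num
            = (x.den : ℤ) ^ 2 - 2 * a * x.num * x.den + x.num ^ 2 by ring] at this
      · have := (hcop.pow_left (m := 2)).add_mul_right_left ((x.den : ℤ) - 2 * a * x.num)
        rwa [show x.num ^ 2 + ((x.den : ℤ) - 2 * a * x.num) * x.den
            = (x.den : ℤ) ^ 2 - 2 * a * x.num * x.den + x.num ^ 2 by ring] at this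
    have hle := Int.le_of_dvd hb (hcop_form.dvd_of_dvd_mul_right (Dvd.intro_left k hmul.symm))
    have hnum_nonneg : 0 ≤ x.num := by
      by_contra! hneg
      have : 1 ≤ -x.num * x.den := by nlinarith
      nlinarith
    have hlt : x.num < x.den := by
      have : x * x.den < 1 * x.den := mul_lt_mul_of_pos_right (abs_lt.1 hx_lt_one).2 hqQ
      rw [hx, one_mul] at this
      exact_mod_cast this
    obtain ⟨p, hp⟩ := Int.eq_ofNat_of_zero_le hnum_nonneg
    rw [hp] at hlt hcop hpos hle
    obtain ⟨n, h₀, h₁⟩ := exists_Fp_of_form_le hb hba p x.den hlt hcop hpos hle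
    refine ⟨n, ?_⟩
    have hbQ : (b : ℚ) ≠ 0 := by exact_mod_cast hb.ne'
    rw [← h₀, ← h₁, ← hp]
    push_cast
    rw [mul_div_mul_left _ _ hbQ, Rat.num_div_den]
  · rintro ⟨n, rfl⟩
    obtain ⟨h₀, h₁⟩ := Fp_nonneg_and_lt_succ ha hb n
    have hpos : (Fp a b (n + 1) : ℚ) ≠ 0 := by exact_mod_cast (h₀.trans_lt h₁).ne'
    have hbQ : (b : ℚ) ≠ 0 := by exact_mod_cast hb.ne'
    have hform : (Fp a b (n + 1) : ℚ) ^ 2 - 2 * a * Fp a b n * Fp a b (n + 1) + Fp a b n ^ 2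
        = b ^ 2 := by exact_mod_cast Fp_succ_sq a b n
    obtain ⟨c, hc⟩ := dvd_Fp a b n
    have hden : 1 - 2 * (a : ℚ) * (Fp a b n / Fp a b (n + 1)) + (Fp a b n / Fp a b (n + 1)) ^ 2
        = b ^ 2 / Fp a b (n + 1) ^ 2 := by
      rw [← hform]
      field_simp
    refine ⟨c * Fp a b (n + 1), ?_⟩
    rw [hden, hc]
    push_cast
    field_simp
end
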